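/- arXiv:1708.06479 — 2 statements merged into one kernel-verified Lean document; each statement's English description precedes it below -/
import Mathlib

section
/- Let b ≥ 2 be an integer and let x be real with 0 ≤ x < 1. Then ∑_{n=1}^{∞} s_b(n)/((x+n)(x+n+1)) = (b/(b−1))·log b + ∑_{n=1}^{∞} (−1)^n·ζ(n+1)·((b^{n+1}−b)/(b^{n+1}−1))·x^n, where ζ(s) = ∑_{k=1}^∞ k^{−s} is the Riemann zeta function. -/
/-- Sum of digits of `n` in base `b`. -/
def digitSum (b n : ℕ) : ℕ := (Nat.digits b n).sum

/-- The Riemann zeta function `ζ(s) = ∑_{k ≥ 1} k^(-s)` for real `s > 1`. -/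
noncomputable def riemannZetaReal (s : ℝ) : ℝ := ∑' k : ℕ, ((k : ℝ) + 1) ^ (-s)

open Filter Topology Finset

theorem digitSum_zero (b : ℕ) : digitSum b 0 = 0 := by simp [digitSum]

theorem digitSum_mul_add {b : ℕ} (hb : 2 ≤ b) (m : ℕ) {r : ℕ} (hr : r < b) :
    digitSum b (b * m + r) = digitSum b m + r := by
  by_cases h : r ≠ 0 ∨ m ≠ 0
  · rw [digitSum, add_comm, Nat.digits_add b (by omega) r m hr h, List.sum_cons, digitSum,
      add_comm]
  · push Not at h
    simp [h.1, h.2, digitSum]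

theorem sum_range_add_div_consecutive (c y : ℝ) (hy : 0 ≤ y) (hc : y = 0 → c = 0) (N : ℕ) :
    ∑ r ∈ range N, (c + r) / ((y + r) * (y + r + 1)) =
      c * N / (y * (y + N)) + ∑ r ∈ range N, 1 / (y + r + 1) - N / (y + N) := by
  induction N with
  | zero => simp
  | succ N ih =>
    rw [sum_range_succ, sum_range_succ, ih]
    push_cast
    have hN : (0 : ℝ) ≤ N := N.cast_nonneg
    rcases hy.eq_or_lt with h | h
    · subst h
      rw [hc rfl]
      rcases hN.eq_or_lt with h0 | h0
      · rw [← h0]; simp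
      · field_simp
        ring
    · have h1 : y + N ≠ 0 := by positivity
      have h2 : y + N + 1 ≠ 0 := by positivity
      have h3 : y + (N + 1) ≠ 0 := by positivity
      field_simp
      ring

/-- Partial sums of the digit sum series satisfy a functional equation in `x` and `x / b`. -/
theorem sum_range_digitSum {b : ℕ} (hb : 2 ≤ b) {x : ℝ} (hx : 0 ≤ x) (M : ℕ) :
    ∑ n ∈ range (b * M), (digitSum b n : ℝ) / ((x + n) * (x + n + 1)) =
      (∑ m ∈ range M, (digitSum b m : ℝ) / ((x / b + m) * (x / b + m + 1))) / b +
        (∑ n ∈ range (b * M), 1 / (x + (n + 1)) - ∑ m ∈ range M, 1 / (x / b + (m + 1))) := by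
  have hb0 : (0 : ℝ) < b := by exact_mod_cast (by omega : 0 < b)
  induction M with
  | zero => simp
  | succ M ih =>
    rw [Nat.mul_succ, sum_range_add, ih, sum_range_succ, sum_range_add, sum_range_succ]
    have hM : (0 : ℝ) ≤ M := M.cast_nonneg
    have key := sum_range_add_div_consecutive (digitSum b M) (x + b * M) (by positivity)
      (fun h => by
        have h1 : (b : ℝ) * M = 0 := by nlinarith [mul_nonneg hb0.le hM]
        have h2 : M = 0 := by
          rcases mul_eq_zero.1 h1 with h | h
          · exact absurd h hb0.ne'
          · exact_mod_cast h
        simp [h2, digitSum_zero]) b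
    have e1 : ∑ r ∈ range b, (digitSum b (b * M + r) : ℝ) /
        ((x + (b * M + r : ℕ)) * (x + (b * M + r : ℕ) + 1)) =
        ∑ r ∈ range b, ((digitSum b M : ℝ) + r) / ((x + b * M + r) * (x + b * M + r + 1)) := by
      refine sum_congr rfl fun r hr => ?_
      rw [digitSum_mul_add hb M (mem_range.1 hr)]
      push_cast
      simp only [add_assoc]
    have e2 : ∑ r ∈ range b, 1 / (x + (((b * M + r : ℕ) : ℝ) + 1)) =
        ∑ r ∈ range b, 1 / (x + b * M + r + 1) := by
      refine sum_congr rfl fun r _ => ?_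
      push_cast
      simp only [add_assoc]
    have e3 : (digitSum b M : ℝ) / ((x / b + M) * (x / b + M + 1)) / b =
        digitSum b M * b / ((x + b * M) * (x + b * M + b)) := by
      have h1 : x / b + M = (x + b * M) / b := by field_simp
      have h2 : x / b + M + 1 = (x + b * M + b) / b := by field_simp
      rw [h2, h1]
      by_cases h : x + b * M = 0
      · simp [h]
      · have : x + b * M + b ≠ 0 := by positivity
        field_simp
    have e4 : 1 / (x / b + (M + 1)) = b / (x + b * M + b) := by
      have : x + b * M + b ≠ 0 := by positivity
      have h3 : x / b + (M + 1) = (x + b * M + b) / b := by field_simp; ring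
      rw [h3]
      field_simp
    rw [e1, e2, key, e4, add_div, e3]
    ring

theorem tendsto_sum_inv_sub_sum_inv {b : ℕ} (hb : 2 ≤ b) :
    Tendsto (fun M : ℕ => ∑ n ∈ range (b * M), 1 / ((n : ℝ) + 1) -
      ∑ m ∈ range M, 1 / ((m : ℝ) + 1)) atTop (𝓝 (Real.log b)) := by
  have hmul : Tendsto (fun M : ℕ => b * M) atTop atTop :=
    tendsto_id.const_mul_atTop' (by omega)
  have h := ((Real.tendsto_harmonic_sub_log.comp hmul).sub
    Real.tendsto_harmonic_sub_log).add_const (Real.log b)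
  rw [sub_self, zero_add] at h
  refine h.congr' ?_
  filter_upwards [eventually_gt_atTop 0] with M hM
  have hM' : (M : ℝ) ≠ 0 := by exact_mod_cast hM.ne'
  have hb' : (b : ℝ) ≠ 0 := by exact_mod_cast (by omega : b ≠ 0)
  simp only [Function.comp, harmonic]
  push_cast
  rw [Real.log_mul hb' hM']
  simp only [one_div]
  ring

theorem riemannZetaReal_nat_add_two (n : ℕ) :
    riemannZetaReal ((n : ℝ) + 2) = ∑' k : ℕ, 1 / ((k : ℝ) + 1) ^ (n + 2) := by
  unfold riemannZetaReal
  refine tsum_congr fun k => ?_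
  rw [Real.rpow_neg (by positivity), one_div, ← Real.rpow_natCast]
  push_cast
  rfl

theorem summable_zeta_double {x : ℝ} (hx0 : 0 ≤ x) (hx1 : x < 1) :
    Summable fun p : ℕ × ℕ => (-1 : ℝ) ^ p.1 * x ^ (p.1 + 1) * (1 / ((p.2 : ℝ) + 1) ^ (p.1 + 2)) := by
  have h2 : Summable fun k : ℕ => 1 / ((k : ℝ) + 1) ^ 2 := by
    have := (summable_nat_add_iff 1).2 (Real.summable_one_div_nat_pow.2 one_lt_two)
    simpa using this
  refine Summable.of_norm_bounded
    ((summable_geometric_of_lt_one hx0 hx1).mul_of_nonneg h2 (fun n => by positivity)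
      (fun k => by positivity)) fun p => ?_
  rw [norm_mul, norm_mul, norm_pow, norm_neg, norm_one, one_pow, one_mul,
    Real.norm_of_nonneg (by positivity), Real.norm_of_nonneg (by positivity)]
  have hk : (1 : ℝ) ≤ (p.2 : ℝ) + 1 := by linarith [(p.2.cast_nonneg : (0 : ℝ) ≤ p.2)]
  refine mul_le_mul (pow_le_pow_of_le_one hx0 hx1.le (Nat.le_succ _)) ?_ (by positivity)
    (by positivity)
  exact one_div_le_one_div_of_le (by positivity) (pow_le_pow_right₀ hk (by omega))

theorem summable_zeta_series {x : ℝ} (hx0 : 0 ≤ x) (hx1 : x < 1) :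
    Summable fun n : ℕ => (-1 : ℝ) ^ n * riemannZetaReal ((n : ℝ) + 2) * x ^ (n + 1) := by
  refine (summable_zeta_double hx0 hx1).prod.congr fun n => ?_
  simp only [tsum_mul_left, riemannZetaReal_nat_add_two]
  ring

theorem hasSum_one_div_sub_one_div {x : ℝ} (hx0 : 0 ≤ x) (hx1 : x < 1) :
    HasSum (fun k : ℕ => 1 / ((k : ℝ) + 1) - 1 / (x + (k + 1)))
      (∑' n : ℕ, (-1 : ℝ) ^ n * riemannZetaReal ((n : ℝ) + 2) * x ^ (n + 1)) := by
  have hs := summable_zeta_double hx0 hx1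
  have e : ∑' p : ℕ × ℕ, (-1 : ℝ) ^ p.1 * x ^ (p.1 + 1) * (1 / ((p.2 : ℝ) + 1) ^ (p.1 + 2)) =
      ∑' n : ℕ, (-1 : ℝ) ^ n * riemannZetaReal ((n : ℝ) + 2) * x ^ (n + 1) := by
    rw [hs.tsum_prod]
    refine tsum_congr fun n => ?_
    simp only [tsum_mul_left, riemannZetaReal_nat_add_two]
    ring
  rw [← e]
  have hsw := (Equiv.prodComm ℕ ℕ).hasSum_iff.2 hs.hasSum
  refine hsw.prod_fiberwise fun k => ?_
  have hk : (0 : ℝ) < (k : ℝ) + 1 := by positivity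
  have hq : |(-(x / ((k : ℝ) + 1)))| < 1 := by
    rw [abs_neg, abs_of_nonneg (by positivity), div_lt_one hk]
    linarith [(k.cast_nonneg : (0 : ℝ) ≤ k)]
  have hg := (hasSum_geometric_of_abs_lt_one hq).mul_left (x / ((k : ℝ) + 1) ^ 2)
  have hv : x / ((k : ℝ) + 1) ^ 2 * (1 - -(x / ((k : ℝ) + 1)))⁻¹ =
      1 / ((k : ℝ) + 1) - 1 / (x + (k + 1)) := by
    have h1 : 1 - -(x / ((k : ℝ) + 1)) = (x + (k + 1)) / (k + 1) := by field_simp; ring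
    have h2 : x + ((k : ℝ) + 1) ≠ 0 := by positivity
    rw [h1]
    field_simp
    ring
  rw [hv] at hg
  refine hg.congr_fun ?_
  intro n
  simp only [Function.comp, Equiv.prodComm_apply, Prod.swap]
  rw [neg_pow (x / ((k : ℝ) + 1)), div_pow]
  field_simp
  ring

theorem tendsto_sum_shift_sub {b : ℕ} (hb : 2 ≤ b) {x : ℝ} (hx0 : 0 ≤ x) (hx1 : x < 1) :
    Tendsto (fun M : ℕ => ∑ n ∈ range (b * M), 1 / (x + ((n : ℝ) + 1)) -
      ∑ m ∈ range M, 1 / (x / b + ((m : ℝ) + 1))) atTop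
      (𝓝 (Real.log b
        - ∑' n : ℕ, (-1 : ℝ) ^ n * riemannZetaReal ((n : ℝ) + 2) * x ^ (n + 1)
        + ∑' n : ℕ, (-1 : ℝ) ^ n * riemannZetaReal ((n : ℝ) + 2) * (x / b) ^ (n + 1))) := by
  have hb1 : (1 : ℝ) ≤ b := by exact_mod_cast (by omega : 1 ≤ b)
  have hmul : Tendsto (fun M : ℕ => b * M) atTop atTop :=
    tendsto_id.const_mul_atTop' (by omega)
  have h1 := (hasSum_one_div_sub_one_div hx0 hx1).tendsto_sum_nat.comp hmul
  have h2 := (hasSum_one_div_sub_one_div (x := x / b) (by positivity)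
    ((div_le_self hx0 hb1).trans_lt hx1)).tendsto_sum_nat
  refine (((tendsto_sum_inv_sub_sum_inv hb).sub h1).add h2).congr fun M => ?_
  simp only [Function.comp, sum_sub_distrib]
  ring

theorem summable_digitSum {b : ℕ} (hb : 2 ≤ b) :
    Summable fun n : ℕ => (digitSum b n : ℝ) / ((0 + n) * (0 + n + 1)) := by
  have hb2 : (2 : ℝ) ≤ b := by exact_mod_cast hb
  obtain ⟨C, hC⟩ := (tendsto_sum_shift_sub hb le_rfl zero_lt_one).bddAbove_range
  refine summable_of_sum_range_le (c := 2 * C) (fun n => by positivity) fun M => ?_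
  have h1 := sum_range_digitSum hb (le_refl (0 : ℝ)) M
  have h2 := hC ⟨M, rfl⟩
  have h3 : ∑ n ∈ range M, (digitSum b n : ℝ) / ((0 + n) * (0 + n + 1)) ≤
      ∑ n ∈ range (b * M), (digitSum b n : ℝ) / ((0 + n) * (0 + n + 1)) :=
    sum_le_sum_of_subset_of_nonneg (range_subset_range.2 (Nat.le_mul_of_pos_left M (by omega)))
      fun n _ _ => by positivity
  have h4 : 0 ≤ ∑ n ∈ range M, (digitSum b n : ℝ) / ((0 + n) * (0 + n + 1)) :=
    sum_nonneg fun n _ => by positivity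
  have h5 := div_le_div_of_nonneg_left h4 two_pos hb2
  simp only [zero_div] at h1 h2
  linarith

theorem digitSum_div_le (b : ℕ) {x : ℝ} (hx0 : 0 ≤ x) (n : ℕ) :
    (digitSum b n : ℝ) / ((x + n) * (x + n + 1)) ≤ digitSum b n / ((0 + n) * (0 + n + 1)) := by
  rcases n.eq_zero_or_pos with rfl | hn
  · simp [digitSum_zero]
  · have : (0 : ℝ) < n := by exact_mod_cast hn
    gcongr

theorem summable_digitSum_shift {b : ℕ} (hb : 2 ≤ b) {x : ℝ} (hx0 : 0 ≤ x) :
    Summable fun n : ℕ => (digitSum b n : ℝ) / ((x + n) * (x + n + 1)) :=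
  (summable_digitSum hb).of_nonneg_of_le (fun n => by positivity) (digitSum_div_le b hx0)

theorem tsum_digitSum_functional {b : ℕ} (hb : 2 ≤ b) {x : ℝ} (hx0 : 0 ≤ x) (hx1 : x < 1) :
    ∑' n : ℕ, (digitSum b n : ℝ) / ((x + n) * (x + n + 1)) =
      (∑' n : ℕ, (digitSum b n : ℝ) / ((x / b + n) * (x / b + n + 1))) / b +
      (Real.log b
        - ∑' n : ℕ, (-1 : ℝ) ^ n * riemannZetaReal ((n : ℝ) + 2) * x ^ (n + 1)
        + ∑' n : ℕ, (-1 : ℝ) ^ n * riemannZetaReal ((n : ℝ) + 2) * (x / b) ^ (n + 1)) := by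
  have hmul : Tendsto (fun M : ℕ => b * M) atTop atTop :=
    tendsto_id.const_mul_atTop' (by omega)
  have h1 := (summable_digitSum_shift hb hx0).hasSum.tendsto_sum_nat.comp hmul
  have h2 := (summable_digitSum_shift hb (x := x / b) (by positivity)).hasSum.tendsto_sum_nat
  refine tendsto_nhds_unique h1
    (((h2.div_const (b : ℝ)).add (tendsto_sum_shift_sub hb hx0 hx1)).congr fun M => ?_)
  exact (sum_range_digitSum hb hx0 M).symm

theorem norm_zeta_ratio_term_le {b : ℕ} (hb : 2 ≤ b) {x y : ℝ} (hy : 0 ≤ y) (hyx : y ≤ x)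
    (n : ℕ) :
    ‖(-1 : ℝ) ^ (n + 1) * riemannZetaReal ((n : ℝ) + 2) *
        (((b : ℝ) ^ (n + 2) - b) / ((b : ℝ) ^ (n + 2) - 1)) * y ^ (n + 1)‖ ≤
      ‖(-1 : ℝ) ^ n * riemannZetaReal ((n : ℝ) + 2) * x ^ (n + 1)‖ := by
  have hb1 : (1 : ℝ) < b := by exact_mod_cast (by omega : 1 < b)
  have h1 : (1 : ℝ) < (b : ℝ) ^ (n + 2) := one_lt_pow₀ hb1 (by omega)
  have h2 : (b : ℝ) ≤ (b : ℝ) ^ (n + 2) := le_self_pow₀ hb1.le (by omega)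
  have h3 : ‖((b : ℝ) ^ (n + 2) - b) / ((b : ℝ) ^ (n + 2) - 1)‖ ≤ 1 := by
    rw [Real.norm_of_nonneg (div_nonneg (by linarith) (by linarith)),
      div_le_one (by linarith)]
    linarith
  have h4 : ‖y ^ (n + 1)‖ ≤ ‖x ^ (n + 1)‖ := by
    rw [Real.norm_of_nonneg (by positivity), Real.norm_of_nonneg (pow_nonneg (hy.trans hyx) _)]
    gcongr
  simp only [norm_mul, norm_pow, norm_neg, norm_one, one_pow, one_mul] at h4 ⊢
  refine mul_le_mul ?_ h4 (by positivity) (by positivity)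
  exact mul_le_of_le_one_right (norm_nonneg _) h3

theorem summable_zeta_ratio {b : ℕ} (hb : 2 ≤ b) {x : ℝ} (hx0 : 0 ≤ x) (hx1 : x < 1) :
    Summable fun n : ℕ => (-1 : ℝ) ^ (n + 1) * riemannZetaReal ((n : ℝ) + 2) *
        (((b : ℝ) ^ (n + 2) - b) / ((b : ℝ) ^ (n + 2) - 1)) * x ^ (n + 1) :=
  .of_norm_bounded (summable_zeta_series hx0 hx1).norm (norm_zeta_ratio_term_le hb hx0 le_rfl)

theorem tsum_zeta_ratio_functional {b : ℕ} (hb : 2 ≤ b) {x : ℝ} (hx0 : 0 ≤ x) (hx1 : x < 1) :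
    ∑' n : ℕ, (-1 : ℝ) ^ (n + 1) * riemannZetaReal ((n : ℝ) + 2) *
        (((b : ℝ) ^ (n + 2) - b) / ((b : ℝ) ^ (n + 2) - 1)) * x ^ (n + 1) =
      (∑' n : ℕ, (-1 : ℝ) ^ (n + 1) * riemannZetaReal ((n : ℝ) + 2) *
        (((b : ℝ) ^ (n + 2) - b) / ((b : ℝ) ^ (n + 2) - 1)) * (x / b) ^ (n + 1)) / b +
      (- ∑' n : ℕ, (-1 : ℝ) ^ n * riemannZetaReal ((n : ℝ) + 2) * x ^ (n + 1)
        + ∑' n : ℕ, (-1 : ℝ) ^ n * riemannZetaReal ((n : ℝ) + 2) * (x / b) ^ (n + 1)) := by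
  have hb1 : (1 : ℝ) < b := by exact_mod_cast (by omega : 1 < b)
  have hy0 : 0 ≤ x / b := by positivity
  have hy1 : x / b < 1 := (div_le_self hx0 hb1.le).trans_lt hx1
  have h := ((summable_zeta_ratio hb hy0 hy1).hasSum.div_const (b : ℝ)).add
    ((summable_zeta_series hx0 hx1).hasSum.neg.add (summable_zeta_series hy0 hy1).hasSum)
  rw [← h.tsum_eq]
  refine tsum_congr fun n => ?_
  have h1 : (b : ℝ) ^ (n + 2) - 1 ≠ 0 := (sub_pos.2 (one_lt_pow₀ hb1 (by omega))).ne'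
  have hb0 : (b : ℝ) ≠ 0 := by positivity
  rw [div_pow]
  field_simp
  ring

/-- A function bounded on `[0, x]` with `D y = D (y / b) / b` there vanishes at `x`. -/
theorem eq_zero_of_div_functional {b x K : ℝ} (hb : 1 < b) (hx0 : 0 ≤ x) {D : ℝ → ℝ}
    (hD : ∀ y, 0 ≤ y → y ≤ x → D y = D (y / b) / b)
    (hK : ∀ y, 0 ≤ y → y ≤ x → |D y| ≤ K) : D x = 0 := by
  have hb0 : 0 < b := one_pos.trans hb
  have key : ∀ k : ℕ, ∀ y, 0 ≤ y → y ≤ x → |D y| ≤ K * (1 / b) ^ k := by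
    intro k
    induction k with
    | zero => simpa using hK
    | succ k ih =>
      intro y hy hyx
      have h := ih (y / b) (by positivity) ((div_le_self hy hb.le).trans hyx)
      rw [hD y hy hyx, abs_div, abs_of_pos hb0, pow_succ, ← mul_assoc, mul_one_div]
      gcongr
  have ht : Tendsto (fun k : ℕ => K * (1 / b) ^ k) atTop (𝓝 (K * 0)) :=
    (tendsto_pow_atTop_nhds_zero_of_lt_one (by positivity)
      ((div_lt_one hb0).2 hb)).const_mul K
  rw [mul_zero] at ht
  exact abs_nonpos_iff.1 (ge_of_tendsto' ht fun k => key k x hx0 le_rfl)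

theorem stmt8 (b : ℕ) (hb : 2 ≤ b) (x : ℝ) (hx0 : 0 ≤ x) (hx1 : x < 1) :
    ∑' n : ℕ, (digitSum b (n + 1) : ℝ) / ((x + (n + 1)) * (x + (n + 1) + 1)) =
    ((b : ℝ) / ((b : ℝ) - 1)) * Real.log b +
      ∑' n : ℕ, (-1 : ℝ) ^ (n + 1) * riemannZetaReal ((n : ℝ) + 2) *
        (((b : ℝ) ^ (n + 2) - b) / ((b : ℝ) ^ (n + 2) - 1)) * x ^ (n + 1) := by
  have hb1 : (1 : ℝ) < b := by exact_mod_cast (by omega : 1 < b)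
  have hshift := (summable_digitSum_shift hb hx0).tsum_eq_zero_add
  simp only [digitSum_zero, Nat.cast_zero, zero_div, zero_add, Nat.cast_add, Nat.cast_one]
    at hshift
  rw [← hshift, ← sub_eq_zero]
  let D : ℝ → ℝ := fun y => ∑' n : ℕ, (digitSum b n : ℝ) / ((y + n) * (y + n + 1)) -
    (((b : ℝ) / ((b : ℝ) - 1)) * Real.log b +
      ∑' n : ℕ, (-1 : ℝ) ^ (n + 1) * riemannZetaReal ((n : ℝ) + 2) *
        (((b : ℝ) ^ (n + 2) - b) / ((b : ℝ) ^ (n + 2) - 1)) * y ^ (n + 1))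
  refine eq_zero_of_div_functional (D := D) hb1 hx0
    (K := ∑' n : ℕ, (digitSum b n : ℝ) / ((0 + n) * (0 + n + 1)) +
      (|((b : ℝ) / ((b : ℝ) - 1)) * Real.log b| +
        ∑' n : ℕ, ‖(-1 : ℝ) ^ n * riemannZetaReal ((n : ℝ) + 2) * x ^ (n + 1)‖)) ?_ ?_
  · intro y hy hyx
    have hy1 := hyx.trans_lt hx1
    simp only [D]
    rw [tsum_digitSum_functional hb hy hy1, tsum_zeta_ratio_functional hb hy hy1]
    have : (b : ℝ) - 1 ≠ 0 := (sub_pos.2 hb1).ne'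
    have hc : (b : ℝ) / (b - 1) * Real.log b =
        (b : ℝ) / (b - 1) * Real.log b / b + Real.log b := by
      field_simp
      ring
    rw [sub_div, add_div]
    linear_combination -hc
  · intro y hy hyx
    refine (abs_sub _ _).trans (add_le_add ?_ ((abs_add_le _ _).trans (add_le_add le_rfl ?_)))
    · rw [abs_of_nonneg (tsum_nonneg fun n => by positivity)]
      exact (summable_digitSum_shift hb hy).tsum_le_tsum (digitSum_div_le b hy)
        (summable_digitSum hb)
    · exact tsum_of_norm_bounded (summable_zeta_series hx0 hx1).norm.hasSum
        (norm_zeta_ratio_term_le hb hy hyx)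
end

section
/- The infinite product ∏_{n=1}^{∞} [ ((1 + 1/n)/(1 + 1/(n+1))) · ((1 + 1/(2n+2))/(1 + 1/(2n))) ]^{s_2(n)} converges and equals π/2. -/
/-- Number of ones in the binary expansion of `n` (sum of base-2 digits). -/
def s2 (n : ℕ) : ℕ := (Nat.digits 2 n).sum

theorem s2_zero : s2 0 = 0 := by simp [s2]

theorem s2_two_mul (n : ℕ) : s2 (2 * n) = s2 n := by
  rcases Nat.eq_zero_or_pos n with rfl | hn
  · simp
  · rw [s2, s2, Nat.digits_def' (by norm_num) (by omega)]
    simp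

theorem s2_two_mul_add_one (n : ℕ) : s2 (2 * n + 1) = s2 n + 1 := by
  rw [s2, s2, Nat.digits_def' (by norm_num) (by omega), List.sum_cons]
  have h₁ : (2 * n + 1) % 2 = 1 := by omega
  have h₂ : (2 * n + 1) / 2 = n := by omega
  rw [h₁, h₂, add_comm]

theorem s2_le_and_sq_le (n : ℕ) : s2 n ≤ n ∧ s2 n ^ 2 ≤ 4 * n := by
  induction n using Nat.strong_induction_on with
  | _ n ih =>
    rcases Nat.even_or_odd' n with ⟨k, rfl | rfl⟩
    · rcases Nat.eq_zero_or_pos k with rfl | hk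
      · simp [s2_zero]
      · obtain ⟨h₁, h₂⟩ := ih k (by omega)
        rw [s2_two_mul]
        omega
    · obtain ⟨h₁, h₂⟩ := ih k (by omega)
      rw [s2_two_mul_add_one]
      constructor
      · omega
      · nlinarith

/-- The decrement of `log (1 + 1 / x)` from `n` to `n + 1`. -/
noncomputable def logDecrement (n : ℕ) : ℝ :=
  Real.log ((1 + 1 / (n : ℝ)) / (1 + 1 / ((n : ℝ) + 1)))

theorem ratio_eq {x : ℝ} (hx : 0 < x) :
    (1 + 1 / x) / (1 + 1 / (x + 1)) = 1 + 1 / (x * (x + 2)) := by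
  field_simp
  ring

theorem logDecrement_nonneg {n : ℕ} (hn : 0 < n) : 0 ≤ logDecrement n := by
  have hx : (0 : ℝ) < n := by exact_mod_cast hn
  rw [logDecrement, ratio_eq hx]
  apply Real.log_nonneg
  have : 0 ≤ 1 / ((n : ℝ) * (n + 2)) := by positivity
  linarith

theorem logDecrement_le {n : ℕ} (hn : 0 < n) : logDecrement n ≤ 1 / (n : ℝ) ^ 2 := by
  have hx : (0 : ℝ) < n := by exact_mod_cast hn
  rw [logDecrement, ratio_eq hx]
  have h₁ : Real.log (1 + 1 / ((n : ℝ) * (n + 2))) ≤ 1 / ((n : ℝ) * (n + 2)) := by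
    have := Real.log_le_sub_one_of_pos (x := 1 + 1 / ((n : ℝ) * (n + 2))) (by positivity)
    linarith
  refine h₁.trans (one_div_le_one_div_of_le (by positivity) ?_)
  nlinarith

theorem summable_s2_mul_logDecrement : Summable fun n => (s2 n : ℝ) * logDecrement n := by
  have hs : Summable fun n : ℕ => 2 * (1 / (n : ℝ) ^ (3 / 2 : ℝ)) :=
    (Real.summable_one_div_nat_rpow.mpr (by norm_num)).mul_left 2
  refine Summable.of_nonneg_of_le (fun n => ?_) (fun n => ?_) hs
  · rcases Nat.eq_zero_or_pos n with rfl | hn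
    · simp [s2_zero]
    · exact mul_nonneg (Nat.cast_nonneg _) (logDecrement_nonneg hn)
  · rcases Nat.eq_zero_or_pos n with rfl | hn
    · simp [s2_zero]
    · have hx : (0 : ℝ) < n := by exact_mod_cast hn
      have hsq : (s2 n : ℝ) ^ 2 ≤ 4 * n := by exact_mod_cast (s2_le_and_sq_le n).2
      have hle : (s2 n : ℝ) ≤ 2 * (n : ℝ) ^ (1 / 2 : ℝ) := by
        rw [← Real.sqrt_eq_rpow]
        apply le_of_sq_le_sq _ (by positivity)
        rw [mul_pow, Real.sq_sqrt hx.le]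
        linarith
      have hpow : (n : ℝ) ^ 2 = (n : ℝ) ^ (1 / 2 : ℝ) * (n : ℝ) ^ (3 / 2 : ℝ) := by
        rw [← Real.rpow_add hx]
        norm_num
      calc (s2 n : ℝ) * logDecrement n
          ≤ (2 * (n : ℝ) ^ (1 / 2 : ℝ)) * (1 / (n : ℝ) ^ 2) :=
            mul_le_mul hle (logDecrement_le hn) (logDecrement_nonneg hn) (by positivity)
        _ = 2 * (1 / (n : ℝ) ^ (3 / 2 : ℝ)) := by
            rw [hpow]
            have : (n : ℝ) ^ (1 / 2 : ℝ) ≠ 0 := by positivity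
            field_simp

theorem hasSum_logDecrement_odd :
    HasSum (fun n => logDecrement (2 * n + 1)) (Real.log (Real.pi / 2)) := by
  rw [hasSum_iff_tendsto_nat_of_nonneg fun n => logDecrement_nonneg (by omega)]
  have hlog := (Real.continuousAt_log (by positivity : Real.pi / 2 ≠ 0)).tendsto.comp
    Real.tendsto_prod_pi_div_two
  refine hlog.congr fun k => ?_
  rw [Function.comp_apply, Real.log_prod fun i _ => by positivity]
  refine Finset.sum_congr rfl fun i _ => ?_
  rw [logDecrement]
  congr 1
  push_cast
  field_simp
  ring

theorem hasSum_s2_mul_logDecrement_sub :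
    HasSum (fun n => (s2 n : ℝ) *
      (logDecrement n - logDecrement (2 * n) - logDecrement (2 * n + 1)))
      (Real.log (Real.pi / 2)) := by
  have h := summable_s2_mul_logDecrement
  have he := (h.comp_injective (i := fun n => 2 * n) fun a b hab => by
    simpa using hab).hasSum
  have ho := (h.comp_injective (i := fun n => 2 * n + 1) fun a b hab => by
    simpa using hab).hasSum
  have hsum := h.hasSum.unique (he.even_add_odd ho)
  have key := (h.hasSum.sub he).sub (ho.sub hasSum_logDecrement_odd)
  rw [hsum, add_sub_cancel_left, sub_sub_cancel] at key
  refine (congrArg (HasSum · _) (funext fun n => ?_)).mpr key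
  simp only [Function.comp_apply, s2_two_mul, s2_two_mul_add_one]
  push_cast
  ring

theorem stmt11 :
    HasProd
      (fun n : ℕ =>
        (((1 + 1 / ((n : ℝ) + 1)) / (1 + 1 / ((n : ℝ) + 2))) *
          ((1 + 1 / (2 * ((n : ℝ) + 1) + 2)) / (1 + 1 / (2 * ((n : ℝ) + 1))))) ^ s2 (n + 1))
      (Real.pi / 2) := by
  have h := ((hasSum_nat_add_iff' 1).mpr hasSum_s2_mul_logDecrement_sub).rexp
  simp only [Finset.sum_range_one, s2_zero, Nat.cast_zero, zero_mul, sub_zero,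
    Real.exp_log (by positivity : 0 < Real.pi / 2)] at h
  convert h using 1
  ext n
  rw [Function.comp_apply, Real.exp_nat_mul, Real.exp_sub, Real.exp_sub]
  simp only [logDecrement]
  rw [Real.exp_log (by positivity), Real.exp_log (by positivity), Real.exp_log (by positivity)]
  congr 1
  push_cast
  have h₁ : (n : ℝ) + 1 + 1 = n + 2 := by ring
  have h₂ : 2 * ((n : ℝ) + 1) + 1 + 1 = 2 * (n + 1) + 2 := by ring
  rw [h₁, h₂]
  field_simp
end
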